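/- The universal associative enveloping algebra U(A^C) = ℚ⟨a,b,c,d⟩/I^C is isomorphic as a ℚ-algebra to the direct product ℚ × M₂(ℚ) × M₂(ℚ), where M₂(ℚ) is the algebra of 2×2 rational matrices. -/

import Mathlib

/-- The free unital associative ℚ-algebra ℚ⟨a,b,c,d⟩ on four generators
`a = e₁₁, b = e₁₂, c = e₂₁, d = e₂₂`. -/
abbrev FreeA : Type := FreeAlgebra ℚ (Fin 4)

/-- The generators `e₁₁ = a, e₁₂ = b, e₂₁ = c, e₂₂ = d` of ℚ⟨a,b,c,d⟩,
indexed by pairs `(i,j)` with `i,j ∈ {1,2}`. -/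
def gen (i j : Fin 2) : FreeA :=
  FreeAlgebra.ι ℚ (⟨2 * i.val + j.val, by omega⟩ : Fin 4)

/-- The 2×2 matrix units `E_ij` over ℚ. -/
noncomputable def matUnit (i j : Fin 2) : Matrix (Fin 2) (Fin 2) ℚ :=
  Matrix.single i j 1

/-- The ℚ-linear map `η : M₂(ℚ) → ℚ⟨a,b,c,d⟩` with `η(E_ij) = e_ij`. -/
noncomputable def eta (x : Matrix (Fin 2) (Fin 2) ℚ) : FreeA :=
  ∑ i : Fin 2, ∑ j : Fin 2, x i j • gen i j

/-- The 64 generators `e_ij e_kl e_st − e_kl e_ij e_st − η([E_ij, E_kl, E_st])`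
of the ideal `I^C`, coming from the special commutator `[x,y,z] = xyz − yxz`
on the associative triple system M₂(ℚ). -/
noncomputable def genSetC : Set FreeA :=
  { g | ∃ i j k l s t : Fin 2,
      g = gen i j * gen k l * gen s t - gen k l * gen i j * gen s t
          - eta (matUnit i j * matUnit k l * matUnit s t
                 - matUnit k l * matUnit i j * matUnit s t) }

/-- The two-sided ideal `I^C` of ℚ⟨a,b,c,d⟩. -/
noncomputable def idealC : TwoSidedIdeal FreeA := TwoSidedIdeal.span genSetC

/-- The relation on ℚ⟨a,b,c,d⟩ identifying each generator of `I^C` with 0;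
quotienting by it yields ℚ⟨a,b,c,d⟩/I^C. -/
noncomputable def relC : FreeA → FreeA → Prop := fun x y => x ∈ genSetC ∧ y = 0

/-- The universal associative enveloping algebra `U(A^C) = ℚ⟨a,b,c,d⟩/I^C`. -/
noncomputable abbrev UC : Type := RingQuot relC

/-- The quotient map ℚ⟨a,b,c,d⟩ → U(A^C). -/
noncomputable def mkC : FreeA →ₐ[ℚ] UC := RingQuot.mkAlgHom ℚ relC

abbrev MQ : Type := Matrix (Fin 2) (Fin 2) ℚ

/-- The composite of `η` with the quotient map, as a linear map. -/
noncomputable def fC : MQ →ₗ[ℚ] UC where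
  toFun X := mkC (eta X)
  map_add' X Y := by
    rw [← map_add]; congr 1
    simp only [eta, Matrix.add_apply, add_smul, Finset.sum_add_distrib]
  map_smul' q X := by
    rw [RingHom.id_apply, ← map_smul]; congr 1
    simp only [eta, Matrix.smul_apply, smul_eq_mul, mul_smul, Finset.smul_sum]

lemma eta_matUnit (i j : Fin 2) : eta (matUnit i j) = gen i j := by
  fin_cases i <;> fin_cases j <;>
    simp [eta, matUnit, Matrix.single_apply]

lemma fC_single (i j : Fin 2) (q : ℚ) :
    fC (Matrix.single i j q) = q • mkC (gen i j) := by
  have h : Matrix.single i j q = q • matUnit i j := by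
    simp [matUnit, Matrix.smul_single]
  rw [h, map_smul]
  change q • mkC (eta (matUnit i j)) = _
  rw [eta_matUnit]

lemma fC_unit (i j k l s t : Fin 2) :
    mkC (gen i j) * mkC (gen k l) * mkC (gen s t)
      - mkC (gen k l) * mkC (gen i j) * mkC (gen s t)
      = fC (matUnit i j * matUnit k l * matUnit s t
        - matUnit k l * matUnit i j * matUnit s t) := by
  have h := RingQuot.mkAlgHom_rel ℚ (s := relC) (x := _) (y := 0)
    ⟨⟨i, j, k, l, s, t, rfl⟩, rfl⟩
  rw [map_sub, map_zero, sub_eq_zero, map_sub, map_mul, map_mul, map_mul, map_mul] at h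
  exact h

lemma fC_rel (X Y Z : MQ) :
    fC X * fC Y * fC Z - fC Y * fC X * fC Z = fC (X * Y * Z - Y * X * Z) := by
  induction X using Matrix.induction_on' with
  | h_zero => simp
  | h_add P Q hP hQ =>
    have e : (P + Q) * Y * Z - Y * (P + Q) * Z
        = (P * Y * Z - Y * P * Z) + (Q * Y * Z - Y * Q * Z) := by noncomm_ring
    rw [e, map_add fC (P * Y * Z - Y * P * Z), ← hP, ← hQ, map_add]; noncomm_ring
  | h_std_basis i j p =>
  induction Y using Matrix.induction_on' with
  | h_zero => simp
  | h_add P Q hP hQ =>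
    generalize Matrix.single i j p = X at *
    have e : X * (P + Q) * Z - (P + Q) * X * Z
        = (X * P * Z - P * X * Z) + (X * Q * Z - Q * X * Z) := by noncomm_ring
    rw [e, map_add fC (X * P * Z - P * X * Z), ← hP, ← hQ, map_add]; noncomm_ring
  | h_std_basis k l q =>
  induction Z using Matrix.induction_on' with
  | h_zero => simp
  | h_add P Q hP hQ =>
    generalize Matrix.single i j p = X at *
    generalize Matrix.single k l q = Y at *
    have e : X * Y * (P + Q) - Y * X * (P + Q)
        = (X * Y * P - Y * X * P) + (X * Y * Q - Y * X * Q) := by noncomm_ring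
    rw [e, map_add fC (X * Y * P - Y * X * P), ← hP, ← hQ, map_add]; noncomm_ring
  | h_std_basis s t r =>
    have hs : ∀ (i j : Fin 2) (q : ℚ), (Matrix.single i j q : MQ) = q • matUnit i j := by
      intro i j q; simp [matUnit, Matrix.smul_single]
    have e : (Matrix.single i j p * Matrix.single k l q * Matrix.single s t r
        - Matrix.single k l q * Matrix.single i j p * Matrix.single s t r : MQ)
        = (p * q * r) • (matUnit i j * matUnit k l * matUnit s t
          - matUnit k l * matUnit i j * matUnit s t) := by
      rw [hs, hs, hs]
      simp only [smul_mul_assoc, mul_smul_comm, smul_smul, smul_sub]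
      congr 2 <;> ring
    rw [e, map_smul, ← fC_unit, fC_single, fC_single, fC_single]
    simp only [smul_mul_assoc, mul_smul_comm, smul_smul, smul_sub]
    congr 2 <;> ring

/-- The defect of multiplicativity for triple products. -/
noncomputable def dC (X Y Z : MQ) : UC := fC X * fC Y * fC Z - fC (X * Y * Z)

lemma dC_move (P Q X Y Z : MQ) :
    dC ((P * Q - Q * P) * X) Y Z = dC X ((P * Q - Q * P) * Y) Z := by
  have hs : ∀ W : MQ, (fC P * fC Q - fC Q * fC P) * fC W = fC ((P * Q - Q * P) * W) := by
    intro W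
    rw [sub_mul, fC_rel, sub_mul]
  generalize P * Q - Q * P = S at *
  generalize fC P * fC Q - fC Q * fC P = s at *
  have h1 := hs (X * Y * Z - Y * X * Z)
  rw [← fC_rel, mul_sub, ← mul_assoc, ← mul_assoc, ← mul_assoc, ← mul_assoc, hs, hs] at h1
  have h2 := fC_rel (S * Y) X Z
  have h3 := congrArg₂ (· + ·) h1 h2
  simp only [sub_add_sub_cancel] at h3
  rw [← map_add] at h3
  unfold dC
  rw [sub_eq_sub_iff_sub_eq_sub, h3, ← map_sub]
  congr 1
  noncomm_ring

lemma dC_sub_left (X X' Y Z : MQ) : dC (X - X') Y Z = dC X Y Z - dC X' Y Z := by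
  simp only [dC, sub_mul, map_sub]; abel

lemma dC_sub_mid (X Y Y' Z : MQ) : dC X (Y - Y') Z = dC X Y Z - dC X Y' Z := by
  simp only [dC, sub_mul, mul_sub, map_sub]; abel

lemma dC_zero (X Y Z : MQ) : dC X Y Z = 0 := by
  have h1 : ∃ P Q : MQ, P * Q - Q * P = !![0, 1; 0, 0] :=
    ⟨!![1, 0; 0, 0], !![0, 1; 0, 0], by ext i j; fin_cases i <;> fin_cases j <;> simp⟩
  have h2 : ∃ P Q : MQ, P * Q - Q * P = !![0, 0; 1, 0] :=
    ⟨!![0, 0; 0, 1], !![0, 0; 1, 0], by ext i j; fin_cases i <;> fin_cases j <;> simp⟩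
  have hW : ((!![0, 1; 0, 0] * !![0, 0; 1, 0] - !![0, 0; 1, 0] * !![0, 1; 0, 0] : MQ)
      * (!![0, 1; 0, 0] * !![0, 0; 1, 0] - !![0, 0; 1, 0] * !![0, 1; 0, 0] : MQ)) = 1 := by
    ext i j; fin_cases i <;> fin_cases j <;> simp
  obtain ⟨P, Q, h1⟩ := h1
  obtain ⟨P', Q', h2⟩ := h2
  have m1 := dC_move P Q
  have m2 := dC_move P' Q'
  rw [h1] at m1
  rw [h2] at m2
  generalize (!![0, 1; 0, 0] : MQ) = S at *
  generalize (!![0, 0; 1, 0] : MQ) = T at *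
  have m3 := dC_move S T
  have key : ∀ X : MQ, dC ((S * T - T * S) * X) Y Z = 0 := by
    intro X
    have e1 := m3 X Y Z
    have e2 : dC ((S * T - T * S) * X) Y Z = - dC X ((S * T - T * S) * Y) Z := by
      rw [sub_mul, sub_mul, dC_sub_left, dC_sub_mid, mul_assoc, mul_assoc, mul_assoc, mul_assoc,
        m1, m2, m2, m1, neg_sub]
    rw [← e1] at e2
    have e3 : (2 : ℚ) • dC ((S * T - T * S) * X) Y Z = 0 := by
      rw [two_smul]
      exact eq_neg_iff_add_eq_zero.mp e2
    exact (smul_eq_zero.mp e3).resolve_left two_ne_zero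
  rw [← one_mul X, ← hW, mul_assoc]
  exact key _

lemma fC_triple (X Y Z : MQ) : fC X * fC Y * fC Z = fC (X * Y * Z) :=
  sub_eq_zero.mp (dC_zero X Y Z)

lemma fC_mul (X Y : MQ) : fC X * fC Y = fC 1 * fC (X * Y) := by
  have h1 := fC_triple 1 1 X
  have h2 := fC_triple 1 X Y
  rw [one_mul, one_mul] at h1
  rw [one_mul] at h2
  rw [← h1, ← h2, mul_assoc, mul_assoc, mul_assoc]

/-- The forward map on the free algebra. -/
noncomputable def phi0 : FreeA →ₐ[ℚ] ℚ × MQ × MQ :=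
  FreeAlgebra.lift ℚ (fun n : Fin 4 =>
    (0, (![matUnit 0 0, matUnit 0 1, matUnit 1 0, matUnit 1 1] n),
      - (![matUnit 0 0, matUnit 0 1, matUnit 1 0, matUnit 1 1] n)))

lemma phi0_gen (i j : Fin 2) : phi0 (gen i j) = (0, matUnit i j, - matUnit i j) := by
  unfold phi0 gen
  rw [FreeAlgebra.lift_ι_apply]
  fin_cases i <;> fin_cases j <;> rfl

lemma sum_matUnit (X : MQ) : ∑ i : Fin 2, ∑ j : Fin 2, X i j • matUnit i j = X := by
  ext i j
  fin_cases i <;> fin_cases j <;> simp [matUnit, Matrix.single_apply]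

lemma phi0_eta (X : MQ) : phi0 (eta X) = (0, X, -X) := by
  conv_rhs => rw [← sum_matUnit X]
  simp only [eta, map_sum, map_smul, phi0_gen]
  simp [Fin.sum_univ_two]
  abel

/-- The forward map. -/
noncomputable def phi : UC →ₐ[ℚ] ℚ × MQ × MQ :=
  RingQuot.liftAlgHom ℚ ⟨phi0, by
    rintro x y ⟨⟨i, j, k, l, s, t, rfl⟩, rfl⟩
    rw [map_zero, map_sub, map_sub, phi0_eta]
    simp only [map_mul, phi0_gen]
    ext1
    · simp
    ext1
    · simp
    · simp; abel⟩

lemma phi_fC (X : MQ) : phi (fC X) = (0, X, -X) := by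
  have h : phi (fC X) = phi0 (eta X) := RingQuot.liftAlgHom_mkAlgHom_apply ..
  rw [h, phi0_eta]

/-- The backward map, as a function. -/
noncomputable def psi (p : ℚ × MQ × MQ) : UC :=
  p.1 • (1 - fC 1 * fC 1) + (1 / 2 : ℚ) • (fC p.2.1 - fC p.2.2
    + fC 1 * fC p.2.1 + fC 1 * fC p.2.2)

lemma psi_add (p r : ℚ × MQ × MQ) : psi (p + r) = psi p + psi r := by
  simp only [psi, Prod.fst_add, Prod.snd_add, map_add, mul_add, add_smul, smul_add, smul_sub]
  abel

lemma psi_smul (q : ℚ) (p : ℚ × MQ × MQ) : psi (q • p) = q • psi p := by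
  simp only [psi, Prod.smul_fst, Prod.smul_snd, map_smul, mul_smul_comm, smul_add, smul_sub,
    smul_eq_mul, mul_smul, smul_comm q (1 / 2 : ℚ)]

lemma psi_one : psi 1 = 1 := by
  simp only [psi, Prod.fst_one, Prod.snd_one, one_smul, sub_self, zero_add]
  rw [← two_smul ℚ, smul_smul]
  norm_num

lemma phi_psi (p : ℚ × MQ × MQ) : phi (psi p) = p := by
  obtain ⟨q, X, Y⟩ := p
  simp only [psi, map_add, map_smul, map_sub, map_mul, map_one, phi_fC]
  ext1
  · simp
  ext1
  · simp
    module
  · simp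
    module

lemma psi_fC_mul (M : MQ) (p : ℚ × MQ × MQ) : psi (phi (fC M) * p) = fC M * psi p := by
  obtain ⟨q, X, Y⟩ := p
  have h1 : ∀ X, fC M * (fC 1 * fC X) = fC (M * X) := by
    intro X; rw [← mul_assoc, fC_triple, mul_one]
  have h2 : ∀ X, fC (-X) = (-1 : ℚ) • fC X := by
    intro X; rw [← map_smul, neg_smul, one_smul]
  have h3 : ∀ X, fC 1 * ((-1 : ℚ) • fC X) = (-1 : ℚ) • (fC 1 * fC X) :=
    fun X => mul_smul_comm _ _ _
  rw [phi_fC]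
  simp only [psi, Prod.mk_mul_mk, zero_mul, zero_smul, zero_add, mul_add, mul_smul_comm, mul_sub,
    mul_one, h1, sub_self, smul_zero, fC_mul M, neg_mul, h2, h3]
  congr 1
  module

lemma psi_mul (u : UC) : ∀ p, psi (phi u * p) = u * psi p := by
  obtain ⟨x, rfl⟩ := RingQuot.mkAlgHom_surjective ℚ relC u
  induction x using FreeAlgebra.induction with
  | grade0 r =>
    intro p
    rw [AlgHom.commutes, AlgHom.commutes, ← Algebra.smul_def, ← Algebra.smul_def, psi_smul]
  | grade1 n =>
    have h : ∃ i j, FreeAlgebra.ι ℚ n = gen i j := by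
      fin_cases n
      exacts [⟨0, 0, rfl⟩, ⟨0, 1, rfl⟩, ⟨1, 0, rfl⟩, ⟨1, 1, rfl⟩]
    obtain ⟨i, j, h⟩ := h
    rw [h, ← eta_matUnit]
    exact psi_fC_mul _
  | mul a b ha hb =>
    intro p
    rw [map_mul, map_mul, mul_assoc, ha, hb, mul_assoc]
  | add a b ha hb =>
    intro p
    rw [map_add, map_add, add_mul, psi_add, ha, hb, add_mul]

/-- The Wedderburn decomposition: `U(A^C)` is isomorphic as a ℚ-algebra to
`ℚ × M₂(ℚ) × M₂(ℚ)`. -/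
theorem UC_wedderburn :
    Nonempty (UC ≃ₐ[ℚ]
      ℚ × Matrix (Fin 2) (Fin 2) ℚ × Matrix (Fin 2) (Fin 2) ℚ) := by
  refine ⟨AlgEquiv.ofBijective phi ⟨?_, fun p => ⟨psi p, phi_psi p⟩⟩⟩
  have h : Function.LeftInverse psi phi := by
    intro u
    have := psi_mul u 1
    rwa [mul_one, psi_one, mul_one] at this
  exact h.injective
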